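/- arXiv:2408.17341 — 2 statements merged into one kernel-verified Lean document; each statement's English description precedes it below -/
import Mathlib

section
/- The Yang–Mills kinematic differential m₁ is a graded derivation of the C∞ product m₂: for all smooth inputs, (i) m₁(λ₁λ₂) = m₂(m₁λ₁, λ₂) + m₂(λ₁, m₁λ₂); (ii) m₁(m₂(λ,(A,φ))) = m₂(m₁λ, (A,φ)) + m₂(λ, m₁(A,φ)); (iii) m₁(m₂((A,φ),λ)) = m₂(m₁(A,φ), λ) − m₂((A,φ), m₁λ); (iv) m₁(m₂((A₁,φ₁),(A₂,φ₂))) = m₂(m₁(A₁,φ₁), (A₂,φ₂)) − m₂((A₁,φ₁), m₁(A₂,φ₂)); (v) m₁(m₂(λ,(E,e))) = m₂(m₁λ, (E,e)) + m₂(λ, m₁(E,e)); (vi) m₁(m₂((E,e),λ)) = m₂(m₁(E,e), λ) + m₂((E,e), m₁λ). -/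
noncomputable section

/-- Points of ℝ^D. -/
abbrev Pt (D : ℕ) := Fin D → ℝ
/-- Scalar fields on ℝ^D. -/
abbrev Fn (D : ℕ) := Pt D → ℝ
/-- Vector fields on ℝ^D (components carry a lower Lorentz index). -/
abbrev Vec (D : ℕ) := Pt D → Fin D → ℝ

/-- Diagonal entries of the Minkowski metric η = diag(−1,1,…,1) (η is its own inverse). -/
def eta (D : ℕ) (μ : Fin D) : ℝ := if (μ : ℕ) = 0 then -1 else 1

/-- Partial derivative ∂_μ. -/
def pd {D : ℕ} (μ : Fin D) (f : Fn D) : Fn D := fun x => fderiv ℝ f x (Pi.single μ 1)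

/-- Minkowski pairing X·Y = η^{μν} X_μ Y_ν. -/
def dot {D : ℕ} (X Y : Vec D) : Fn D := fun x => ∑ μ, eta D μ * X x μ * Y x μ

/-- Divergence ∂·X = ∂^μ X_μ. -/
def divg {D : ℕ} (X : Vec D) : Fn D := fun x => ∑ μ, eta D μ * pd μ (fun y => X y μ) x

/-- Gradient (∂f)_μ = ∂_μ f. -/
def grad {D : ℕ} (f : Fn D) : Vec D := fun x μ => pd μ f x

/-- Wave operator □ = ∂^μ∂_μ on scalars. -/
def box {D : ℕ} (f : Fn D) : Fn D := fun x => ∑ μ, eta D μ * pd μ (pd μ f) x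

/-- Wave operator acting componentwise on vector fields. -/
def boxV {D : ℕ} (X : Vec D) : Vec D := fun x μ => box (fun y => X y μ) x

/-- Generalized Lie derivative product: (X*Y)_μ = X^ν ∂_ν Y_μ + (∂_μ X_ν − ∂_ν X_μ) Y^ν. -/
def starP {D : ℕ} (X Y : Vec D) : Vec D := fun x μ =>
  ∑ ν, eta D ν * (X x ν * pd ν (fun y => Y y μ) x
    + (pd μ (fun y => X y ν) x - pd ν (fun y => X y μ) x) * Y x ν)

/-- Bullet product X•Y = (∂·X)Y − (∂·Y)X + X*Y − Y*X. -/
def bullet {D : ℕ} (X Y : Vec D) : Vec D :=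
  fun x μ => divg X x * Y x μ - divg Y x * X x μ + starP X Y x μ - starP Y X x μ

/-- Pointwise product of scalar fields. -/
def fmul {D : ℕ} (f g : Fn D) : Fn D := fun x => f x * g x

/-- Pointwise scaling of a vector field by a scalar field. -/
def fsmul {D : ℕ} (f : Fn D) (X : Vec D) : Vec D := fun x μ => f x * X x μ

/-- Smoothness of scalar fields. -/
def SmF {D : ℕ} (f : Fn D) : Prop := ContDiff ℝ (⊤ : ℕ∞) f

/-- Smoothness of vector fields. -/
def SmV {D : ℕ} (X : Vec D) : Prop := ∀ μ, ContDiff ℝ (⊤ : ℕ∞) fun x => X x μ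

/-- Differential m₁ : K₀ → K₁, λ ↦ (∂λ, □λ). -/
def m1₀ {D : ℕ} (l : Fn D) : Vec D × Fn D := (grad l, box l)

/-- Differential m₁ : K₁ → K₂, (A,φ) ↦ (□A − ∂φ, ∂·A − φ). -/
def m1₁ {D : ℕ} (a : Vec D × Fn D) : Vec D × Fn D :=
  (fun x μ => boxV a.1 x μ - grad a.2 x μ, fun x => divg a.1 x - a.2 x)

/-- Differential m₁ : K₂ → K₃, (E,e) ↦ □e − ∂·E. -/
def m1₂ {D : ℕ} (e : Vec D × Fn D) : Fn D := fun x => box e.2 x - divg e.1 x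

/-- m₂ on K₀ ⊗ K₀. -/
def m2₀₀ {D : ℕ} (l1 l2 : Fn D) : Fn D := fmul l1 l2

/-- m₂ on K₀ ⊗ K₁: m₂(λ,(A,φ)) = (λA, ∂·(λA)). -/
def m2₀₁ {D : ℕ} (l : Fn D) (a : Vec D × Fn D) : Vec D × Fn D :=
  (fsmul l a.1, divg (fsmul l a.1))

/-- m₂ on K₁ ⊗ K₀: m₂((A,φ),λ) = (λA, ∂·(λA)). -/
def m2₁₀ {D : ℕ} (a : Vec D × Fn D) (l : Fn D) : Vec D × Fn D :=
  (fsmul l a.1, divg (fsmul l a.1))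

/-- m₂ on K₀ ⊗ K₂: m₂(λ,(E,e)) = (λ(E − ∂e), 0). -/
def m2₀₂ {D : ℕ} (l : Fn D) (e : Vec D × Fn D) : Vec D × Fn D :=
  (fun x μ => l x * (e.1 x μ - grad e.2 x μ), 0)

/-- m₂ on K₂ ⊗ K₀: m₂((E,e),λ) = (λ(E − ∂e), 0). -/
def m2₂₀ {D : ℕ} (e : Vec D × Fn D) (l : Fn D) : Vec D × Fn D :=
  (fun x μ => l x * (e.1 x μ - grad e.2 x μ), 0)

/-- m₂ on K₁ ⊗ K₁: m₂((A₁,φ₁),(A₂,φ₂)) = (A₁•A₂, 0). -/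
def m2₁₁ {D : ℕ} (a1 a2 : Vec D × Fn D) : Vec D × Fn D := (bullet a1.1 a2.1, 0)

/-- m₂ on K₁ ⊗ K₂: m₂((A,φ),(E,e)) = A·(∂e − E). -/
def m2₁₂ {D : ℕ} (a e : Vec D × Fn D) : Fn D :=
  dot a.1 (fun x μ => grad e.2 x μ - e.1 x μ)

/-- m₂ on K₂ ⊗ K₁: m₂((E,e),(A,φ)) = A·(∂e − E). -/
def m2₂₁ {D : ℕ} (e a : Vec D × Fn D) : Fn D :=
  dot a.1 (fun x μ => grad e.2 x μ - e.1 x μ)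

/-- m₂ on K₀ ⊗ K₃: m₂(λ,N) = λN. -/
def m2₀₃ {D : ℕ} (l N : Fn D) : Fn D := fmul l N

/-- m₂ on K₃ ⊗ K₀: m₂(N,λ) = λN. -/
def m2₃₀ {D : ℕ} (N l : Fn D) : Fn D := fmul l N

section PartialDerivatives

variable {D : ℕ} {f g : Fn D}

theorem SmF.differentiableAt (hf : SmF f) (x : Pt D) : DifferentiableAt ℝ f x :=
  (ContDiff.differentiable hf (by simp)).differentiableAt

theorem SmF.pd (hf : SmF f) (μ : Fin D) : SmF (pd μ f) :=
  (hf.fderiv_right (m := (⊤ : ℕ∞)) (by simp)).clm_apply contDiff_const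

theorem SmF.add (hf : SmF f) (hg : SmF g) : SmF fun y => f y + g y := ContDiff.add hf hg

theorem SmF.sub (hf : SmF f) (hg : SmF g) : SmF fun y => f y - g y := ContDiff.sub hf hg

theorem SmF.mul (hf : SmF f) (hg : SmF g) : SmF fun y => f y * g y := ContDiff.mul hf hg

theorem SmF.const_mul (hf : SmF f) (c : ℝ) : SmF fun y => c * f y :=
  ContDiff.mul contDiff_const hf

theorem SmF.sum {F : Fin D → Fn D} (hF : ∀ ν, SmF (F ν)) : SmF fun y => ∑ ν, F ν y :=
  ContDiff.sum fun ν _ => hF ν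

theorem SmF.divg {X : Vec D} (hX : SmV X) : SmF (divg X) :=
  SmF.sum fun ν => (SmF.pd (hX ν) ν).const_mul _

theorem pd_add (hf : SmF f) (hg : SmF g) (μ : Fin D) (x : Pt D) :
    pd μ (fun y => f y + g y) x = pd μ f x + pd μ g x := by
  simp [pd, fderiv_fun_add (hf.differentiableAt x) (hg.differentiableAt x)]

theorem pd_sub (hf : SmF f) (hg : SmF g) (μ : Fin D) (x : Pt D) :
    pd μ (fun y => f y - g y) x = pd μ f x - pd μ g x := by
  simp [pd, fderiv_fun_sub (hf.differentiableAt x) (hg.differentiableAt x)]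

theorem pd_mul (hf : SmF f) (hg : SmF g) (μ : Fin D) (x : Pt D) :
    pd μ (fun y => f y * g y) x = f x * pd μ g x + g x * pd μ f x := by
  simp [pd, fderiv_fun_mul (hf.differentiableAt x) (hg.differentiableAt x)]

theorem pd_const_mul (hf : SmF f) (c : ℝ) (μ : Fin D) (x : Pt D) :
    pd μ (fun y => c * f y) x = c * pd μ f x := by
  simp [pd, fderiv_const_mul (hf.differentiableAt x)]

theorem pd_sum {F : Fin D → Fn D} (hF : ∀ ν, SmF (F ν)) (μ : Fin D) (x : Pt D) :
    pd μ (fun y => ∑ ν, F ν y) x = ∑ ν, pd μ (F ν) x := by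
  simp [pd, fderiv_fun_sum fun ν _ => (hF ν).differentiableAt x]

theorem pd_comm (hf : SmF f) (μ ν : Fin D) (x : Pt D) :
    pd μ (pd ν f) x = pd ν (pd μ f) x := by
  have hd : DifferentiableAt ℝ (fderiv ℝ f) x :=
    ((hf.fderiv_right (m := (⊤ : ℕ∞)) (by simp)).differentiable (by simp)).differentiableAt
  have key (u v : Pt D) :
      fderiv ℝ (fun y => fderiv ℝ f y u) x v = fderiv ℝ (fderiv ℝ f) x v u := by
    simp [fderiv_clm_apply hd (differentiableAt_const u)]
  have hs : IsSymmSndFDerivAt ℝ f x := hf.contDiffAt.isSymmSndFDerivAt (by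
    simpa using WithTop.coe_le_coe.2 (le_top : (2 : ℕ∞) ≤ ⊤))
  exact (key _ _).trans ((hs _ _).trans (key _ _).symm)

theorem pd_divg {X : Vec D} (hX : SmV X) (μ : Fin D) (x : Pt D) :
    pd μ (divg X) x = ∑ ν, eta D ν * pd μ (pd ν fun y => X y ν) x := by
  unfold divg
  rw [pd_sum fun ν => (SmF.pd (hX ν) ν).const_mul _]
  exact Finset.sum_congr rfl fun ν _ => pd_const_mul (SmF.pd (hX ν) ν) _ _ _

end PartialDerivatives

section VectorCalculus

variable {D : ℕ} {f g : Fn D} {X Y : Vec D}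

theorem SmV.grad (hf : SmF f) : SmV (grad f) := fun μ => hf.pd μ

theorem SmV.sub (hX : SmV X) (hY : SmV Y) : SmV fun x μ => X x μ - Y x μ :=
  fun μ => SmF.sub (hX μ) (hY μ)

theorem SmV.fsmul (hf : SmF f) (hX : SmV X) : SmV (fsmul f X) :=
  fun μ => SmF.mul hf (hX μ)

theorem divg_grad (f : Fn D) : divg (grad f) = box f := rfl

theorem divg_add (hX : SmV X) (hY : SmV Y) (x : Pt D) :
    divg (X + Y) x = divg X x + divg Y x := by
  simp only [divg, Pi.add_apply, pd_add (hX _) (hY _), mul_add, Finset.sum_add_distrib]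

theorem divg_sub (hX : SmV X) (hY : SmV Y) (x : Pt D) :
    divg (fun y μ => X y μ - Y y μ) x = divg X x - divg Y x := by
  simp only [divg, pd_sub (hX _) (hY _), mul_sub, Finset.sum_sub_distrib]

theorem divg_fsmul (hf : SmF f) (hX : SmV X) (x : Pt D) :
    divg (fsmul f X) x = f x * divg X x + dot (grad f) X x := by
  simp only [divg, fsmul, dot, grad, pd_mul hf (hX _), Finset.mul_sum, ← Finset.sum_add_distrib]
  exact Finset.sum_congr rfl fun ν _ => by ring

theorem box_zero (x : Pt D) : box (0 : Fn D) x = 0 := by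
  have h (μ : Fin D) : pd μ (0 : Fn D) = 0 := by
    funext y
    simp [pd]
  simp [box, h]

theorem grad_fmul (hf : SmF f) (hg : SmF g) :
    grad (fmul f g) = fsmul g (grad f) + fsmul f (grad g) := by
  funext x μ
  exact (pd_mul hf hg μ x).trans (add_comm _ _)

theorem box_fmul (hf : SmF f) (hg : SmF g) (x : Pt D) :
    box (fmul f g) x = divg (fsmul g (grad f)) x + divg (fsmul f (grad g)) x := by
  rw [← divg_grad, grad_fmul hf hg, divg_add (.fsmul hg (.grad hf)) (.fsmul hf (.grad hg))]

theorem bullet_antisymm (X Y : Vec D) : bullet X Y = -bullet Y X := by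
  funext x μ
  simp only [bullet, Pi.neg_apply]
  ring

/-- The second-order operator `□X - ∂(∂·X)` fails to be linear over functions by `∂f • X`. -/
theorem boxV_fsmul_sub_grad_divg (hf : SmF f) (hX : SmV X) (x : Pt D) (μ : Fin D) :
    boxV (fsmul f X) x μ - grad (divg (fsmul f X)) x μ
      = bullet (grad f) X x μ + f x * (boxV X x μ - grad (divg X) x μ) := by
  have hpp (ν κ τ : Fin D) : pd ν (pd κ fun y => f y * X y τ) x
      = f x * pd ν (pd κ fun y => X y τ) x + pd κ (fun y => X y τ) x * pd ν f x
        + (X x τ * pd ν (pd κ f) x + pd κ f x * pd ν (fun y => X y τ) x) := by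
    have h : pd κ (fun y => f y * X y τ)
        = fun y => f y * pd κ (fun y => X y τ) y + X y τ * pd κ f y :=
      funext fun y => pd_mul hf (hX τ) κ y
    rw [h, pd_add (hf.mul (SmF.pd (hX τ) κ)) (SmF.mul (hX τ) (hf.pd κ)),
      pd_mul hf (SmF.pd (hX τ) κ), pd_mul (hX τ) (hf.pd κ)]
  have hgrad (κ : Fin D) : (fun y => grad f y κ) = pd κ f := rfl
  simp only [bullet, starP, hgrad, divg_grad]
  simp only [grad, pd_divg hX, pd_divg (SmV.fsmul hf hX)]
  simp only [boxV, box, divg, fsmul, hpp]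
  simp only [Finset.mul_sum, Finset.sum_mul, ← Finset.sum_add_distrib, ← Finset.sum_sub_distrib]
  refine Finset.sum_congr rfl fun ν _ => ?_
  rw [pd_comm hf μ ν]
  ring

theorem sum_sum_eq_zero_of_antisymm {ι : Type*} [Fintype ι] {F : ι → ι → ℝ}
    (h : ∀ μ ν, F μ ν + F ν μ = 0) : ∑ μ, ∑ ν, F μ ν = 0 := by
  have h2 : ∑ μ, ∑ ν, F μ ν + ∑ μ, ∑ ν, F ν μ = 0 := by
    simp [← Finset.sum_add_distrib, h]
  rw [Finset.sum_comm (f := fun μ ν => F ν μ)] at h2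
  linarith

theorem starP_summand_smooth (hX : SmV X) (hY : SmV Y) (μ ν : Fin D) :
    SmF fun y => X y ν * pd ν (fun z => Y z μ) y
      + (pd μ (fun z => X z ν) y - pd ν (fun z => X z μ) y) * Y y ν :=
  (SmF.mul (hX ν) (SmF.pd (hY μ) ν)).add
    (((SmF.pd (hX ν) μ).sub (SmF.pd (hX μ) ν)).mul (hY ν))

theorem SmV.starP (hX : SmV X) (hY : SmV Y) : SmV (starP X Y) := fun μ =>
  SmF.sum fun ν => (starP_summand_smooth hX hY μ ν).const_mul _

theorem pd_starP (hX : SmV X) (hY : SmV Y) (μ κ : Fin D) (x : Pt D) :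
    pd κ (fun y => starP X Y y μ) x = ∑ ν, eta D ν *
      (X x ν * pd κ (pd ν fun y => Y y μ) x + pd ν (fun y => Y y μ) x * pd κ (fun y => X y ν) x
        + ((pd μ (fun y => X y ν) x - pd ν (fun y => X y μ) x) * pd κ (fun y => Y y ν) x
          + Y x ν * (pd κ (pd μ fun y => X y ν) x - pd κ (pd ν fun y => X y μ) x))) := by
  unfold starP
  rw [pd_sum fun ν => (starP_summand_smooth hX hY μ ν).const_mul _]
  refine Finset.sum_congr rfl fun ν _ => ?_
  have hF := SmF.sub (SmF.pd (hX ν) μ) (SmF.pd (hX μ) ν)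
  rw [pd_const_mul (starP_summand_smooth hX hY μ ν),
    pd_add (SmF.mul (hX ν) (SmF.pd (hY μ) ν)) (hF.mul (hY ν)),
    pd_mul (hX ν) (SmF.pd (hY μ) ν), pd_mul hF (hY ν),
    pd_sub (SmF.pd (hX ν) μ) (SmF.pd (hX μ) ν)]

theorem pd_bullet (hX : SmV X) (hY : SmV Y) (μ κ : Fin D) (x : Pt D) :
    pd κ (fun y => bullet X Y y μ) x
      = divg X x * pd κ (fun y => Y y μ) x + Y x μ * pd κ (divg X) x
        - (divg Y x * pd κ (fun y => X y μ) x + X x μ * pd κ (divg Y) x)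
        + pd κ (fun y => starP X Y y μ) x - pd κ (fun y => starP Y X y μ) x := by
  have h1 := (SmF.divg hX).mul (hY μ)
  have h2 := (SmF.divg hY).mul (hX μ)
  have h3 := SmV.starP hX hY μ
  unfold bullet
  rw [pd_sub ((h1.sub h2).add h3) (SmV.starP hY hX μ), pd_add (h1.sub h2) h3, pd_sub h1 h2,
    pd_mul (SmF.divg hX) (hY μ), pd_mul (SmF.divg hY) (hX μ)]

theorem divg_bullet (hX : SmV X) (hY : SmV Y) (x : Pt D) :
    divg (bullet X Y) x = dot X (fun y μ => grad (divg Y) y μ - boxV Y y μ) x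
      - dot Y (fun y μ => grad (divg X) y μ - boxV X y μ) x := by
  rw [← sub_eq_zero]
  simp only [divg.eq_1 (bullet X Y), pd_bullet hX hY, pd_starP hX hY, pd_starP hY hX, dot, grad,
    pd_divg hX, pd_divg hY, boxV, box]
  simp only [divg, Finset.mul_sum, Finset.sum_mul, ← Finset.sum_add_distrib,
    ← Finset.sum_sub_distrib]
  refine sum_sum_eq_zero_of_antisymm fun μ ν => ?_
  rw [pd_comm (hX μ) ν μ, pd_comm (hX ν) ν μ, pd_comm (hY μ) ν μ, pd_comm (hY ν) ν μ]
  ring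

end VectorCalculus

/-- the Yang–Mills kinematic differential m₁ is a graded derivation of the
C∞ product m₂, in all components of the kinematic complex K (outputs of degree ≤ 3). -/
theorem m1_graded_derivation_m2 {D : ℕ} (hD : 1 ≤ D)
    (l l1 l2 : Fn D) (a a1 a2 e : Vec D × Fn D)
    (hl : SmF l) (hl1 : SmF l1) (hl2 : SmF l2)
    (haV : SmV a.1) (haF : SmF a.2) (ha1V : SmV a1.1) (ha1F : SmF a1.2)
    (ha2V : SmV a2.1) (ha2F : SmF a2.2) (heV : SmV e.1) (heF : SmF e.2) :
    -- (i)  m₁(λ₁λ₂) = m₂(m₁λ₁, λ₂) + m₂(λ₁, m₁λ₂)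
    m1₀ (m2₀₀ l1 l2) = m2₁₀ (m1₀ l1) l2 + m2₀₁ l1 (m1₀ l2) ∧
    -- (ii)  m₁(m₂(λ,(A,φ))) = m₂(m₁λ,(A,φ)) + m₂(λ, m₁(A,φ))
    m1₁ (m2₀₁ l a) = m2₁₁ (m1₀ l) a + m2₀₂ l (m1₁ a) ∧
    -- (iii)  m₁(m₂((A,φ),λ)) = m₂(m₁(A,φ),λ) − m₂((A,φ), m₁λ)
    m1₁ (m2₁₀ a l) = m2₂₀ (m1₁ a) l - m2₁₁ a (m1₀ l) ∧
    -- (iv)  m₁(m₂((A₁,φ₁),(A₂,φ₂))) = m₂(m₁(A₁,φ₁),(A₂,φ₂)) − m₂((A₁,φ₁), m₁(A₂,φ₂))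
    m1₂ (m2₁₁ a1 a2) = m2₂₁ (m1₁ a1) a2 - m2₁₂ a1 (m1₁ a2) ∧
    -- (v)  m₁(m₂(λ,(E,e))) = m₂(m₁λ,(E,e)) + m₂(λ, m₁(E,e))
    m1₂ (m2₀₂ l e) = m2₁₂ (m1₀ l) e + m2₀₃ l (m1₂ e) ∧
    -- (vi)  m₁(m₂((E,e),λ)) = m₂(m₁(E,e),λ) + m₂((E,e), m₁λ)
    m1₂ (m2₂₀ e l) = m2₃₀ (m1₂ e) l + m2₂₁ e (m1₀ l) := by
  have hii (b : Vec D × Fn D) (hb : SmV b.1) (hbF : SmF b.2) :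
      m1₁ (m2₀₁ l b) = m2₁₁ (m1₀ l) b + m2₀₂ l (m1₁ b) := by
    refine Prod.ext (funext₂ fun x μ => ?_) (funext fun x => ?_)
    · have hg : grad (fun y => divg b.1 y - b.2 y) x μ = grad (divg b.1) x μ - grad b.2 x μ :=
        pd_sub (.divg hb) hbF μ x
      simp only [m1₁, m2₀₁, m2₁₁, m1₀, m2₀₂, Prod.fst_add, Pi.add_apply,
        boxV_fsmul_sub_grad_divg hl hb, hg]
      ring
    · simp [m1₁, m2₀₁, m2₁₁, m2₀₂]
  have hv (x : Pt D) : m1₂ (m2₀₂ l e) x = m2₁₂ (m1₀ l) e x + m2₀₃ l (m1₂ e) x := by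
    have hE := heV.sub (.grad heF)
    have hd := divg_fsmul hl hE x
    have hdot : dot (grad l) (fun y μ => grad e.2 y μ - e.1 y μ) x
        = -dot (grad l) (fun y μ => e.1 y μ - grad e.2 y μ) x := by
      simp only [dot, ← Finset.sum_neg_distrib]
      exact Finset.sum_congr rfl fun μ _ => by ring
    rw [divg_sub heV (.grad heF), divg_grad] at hd
    unfold fsmul at hd
    simp only [m1₂, m2₀₂, m2₁₂, m1₀, m2₀₃, fmul, box_zero, hd, hdot]
    ring
  refine ⟨?_, hii a haV haF, ?_, ?_, funext hv, ?_⟩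
  · exact Prod.ext (grad_fmul hl1 hl2) (funext (box_fmul hl1 hl2))
  · have h := hii a haV haF
    have hb : m2₁₁ a (m1₀ l) = -m2₁₁ (m1₀ l) a :=
      Prod.ext (bullet_antisymm _ _) (by simp [m2₁₁])
    rw [hb, sub_neg_eq_add, add_comm]
    exact h
  · funext x
    have hg (b : Vec D × Fn D) (hb : SmV b.1) (hbF : SmF b.2) :
        (fun y μ => grad (m1₁ b).2 y μ - (m1₁ b).1 y μ)
          = fun y μ => grad (divg b.1) y μ - boxV b.1 y μ := by
      funext y μ
      have := pd_sub (.divg hb) hbF μ y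
      simp only [m1₁, grad, this]
      ring
    simp only [Pi.sub_apply, m2₂₁, m2₁₂, hg a1 ha1V ha1F, hg a2 ha2V ha2F]
    simp only [m1₂, m2₁₁, box_zero, divg_bullet ha1V ha2V]
    ring
  · rw [add_comm]
    exact funext hv
end
end

section
/- The products m₂ and m₃ of the Yang–Mills kinematic C∞ algebra are compatible with vanishing four-product m₄: (i) for all smooth gauge fields a₁ = (A₁,φ₁), …, a₄ = (A₄,φ₄) in K₁, m₂(m₃(a₁,a₂,a₃), a₄) = m₂(a₁, m₃(a₂,a₃,a₄)); equivalently A₄·[(A₁·A₂)A₃ + (A₂·A₃)A₁ − 2(A₁·A₃)A₂] = A₁·[(A₂·A₃)A₄ + (A₃·A₄)A₂ − 2(A₂·A₄)A₃]; and (ii) for every smooth gauge parameter λ, m₃(m₂(λ,a₂), a₃, a₄) = m₂(λ, m₃(a₂,a₃,a₄)). -/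
noncomputable section

/-- The three-product m₃ on K₁ ⊗ K₁ ⊗ K₁:
m₃((A₁,φ₁),(A₂,φ₂),(A₃,φ₃)) = ((A₁·A₂)A₃ + (A₂·A₃)A₁ − 2(A₁·A₃)A₂, 0) ∈ K₂. -/
def m3 {D : ℕ} (a1 a2 a3 : Vec D × Fn D) : Vec D × Fn D :=
  (fun x μ => dot a1.1 a2.1 x * a3.1 x μ + dot a2.1 a3.1 x * a1.1 x μ
      - 2 * dot a1.1 a3.1 x * a2.1 x μ, 0)

theorem dot_comm {D : ℕ} (X Y : Vec D) : dot X Y = dot Y X := by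
  funext x
  exact Finset.sum_congr rfl fun μ _ => by ring

theorem dot_neg_right {D : ℕ} (X Y : Vec D) : dot X (-Y) = -dot X Y := by
  funext x
  simp [dot]

theorem dot_fsmul_left {D : ℕ} (l : Fn D) (X Y : Vec D) :
    dot (fsmul l X) Y = fmul l (dot X Y) := by
  funext x
  simp only [dot, fsmul, fmul, Finset.mul_sum]
  exact Finset.sum_congr rfl fun μ _ => by ring

theorem dot_m3_fst {D : ℕ} (X : Vec D) (a b c : Vec D × Fn D) (x : Pt D) :
    dot X (m3 a b c).1 x = dot a.1 b.1 x * dot X c.1 x + dot b.1 c.1 x * dot X a.1 x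
      - 2 * dot a.1 c.1 x * dot X b.1 x := by
  change ∑ μ, eta D μ * X x μ * (dot a.1 b.1 x * c.1 x μ + dot b.1 c.1 x * a.1 x μ
    - 2 * dot a.1 c.1 x * b.1 x μ) = dot a.1 b.1 x * (∑ μ, eta D μ * X x μ * c.1 x μ)
    + dot b.1 c.1 x * (∑ μ, eta D μ * X x μ * a.1 x μ)
    - 2 * dot a.1 c.1 x * (∑ μ, eta D μ * X x μ * b.1 x μ)
  rw [Finset.mul_sum, Finset.mul_sum, Finset.mul_sum, ← Finset.sum_add_distrib,
    ← Finset.sum_sub_distrib]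
  exact Finset.sum_congr rfl fun μ _ => by ring

theorem dot_m3_fst_cyclic {D : ℕ} (a1 a2 a3 a4 : Vec D × Fn D) :
    dot a4.1 (m3 a1 a2 a3).1 = dot a1.1 (m3 a2 a3 a4).1 := by
  funext x
  rw [dot_m3_fst, dot_m3_fst, dot_comm a4.1 a3.1, dot_comm a4.1 a1.1, dot_comm a4.1 a2.1]
  ring

theorem grad_zero {D : ℕ} : grad (0 : Fn D) = 0 := by
  funext x μ
  simp [grad, pd]

theorem m2₁₂_of_snd_eq_zero {D : ℕ} (a e : Vec D × Fn D) (he : e.2 = 0) :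
    m2₁₂ a e = -dot a.1 e.1 := by
  rw [← dot_neg_right, m2₁₂, he, grad_zero]
  congr 1
  funext x μ
  simp

theorem m2₀₂_of_snd_eq_zero {D : ℕ} (l : Fn D) (e : Vec D × Fn D) (he : e.2 = 0) :
    m2₀₂ l e = (fsmul l e.1, 0) := by
  rw [m2₀₂, he, grad_zero]
  congr 1
  funext x μ
  simp [fsmul]

theorem m3_m2₀₁ {D : ℕ} (l : Fn D) (a b c : Vec D × Fn D) :
    m3 (m2₀₁ l a) b c = (fsmul l (m3 a b c).1, 0) := by
  simp only [m3, m2₀₁, dot_fsmul_left]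
  congr 1
  funext x μ
  simp only [fsmul, fmul]
  ring

/-- compatibility of m₂ and m₃ with vanishing four-product m₄:
(i) m₂(m₃(a₁,a₂,a₃),a₄) = m₂(a₁,m₃(a₂,a₃,a₄)), equivalently
A₄·[(A₁·A₂)A₃ + (A₂·A₃)A₁ − 2(A₁·A₃)A₂] = A₁·[(A₂·A₃)A₄ + (A₃·A₄)A₂ − 2(A₂·A₄)A₃];
(ii) m₃(m₂(λ,a₂),a₃,a₄) = m₂(λ,m₃(a₂,a₃,a₄)). -/
theorem m2_m3_compatibility_m4_zero {D : ℕ} (hD : 1 ≤ D)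
    (l : Fn D) (a1 a2 a3 a4 : Vec D × Fn D) (hl : SmF l)
    (ha1V : SmV a1.1) (ha1F : SmF a1.2) (ha2V : SmV a2.1) (ha2F : SmF a2.2)
    (ha3V : SmV a3.1) (ha3F : SmF a3.2) (ha4V : SmV a4.1) (ha4F : SmF a4.2) :
    -- (i)
    m2₂₁ (m3 a1 a2 a3) a4 = m2₁₂ a1 (m3 a2 a3 a4) ∧
    dot a4.1 (m3 a1 a2 a3).1 = dot a1.1 (m3 a2 a3 a4).1 ∧
    -- (ii)
    m3 (m2₀₁ l a2) a3 a4 = m2₀₂ l (m3 a2 a3 a4) := by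
  have h := dot_m3_fst_cyclic a1 a2 a3 a4
  refine ⟨?_, h, ?_⟩
  · change m2₁₂ a4 (m3 a1 a2 a3) = _
    rw [m2₁₂_of_snd_eq_zero _ _ rfl, m2₁₂_of_snd_eq_zero _ _ rfl, h]
  · rw [m3_m2₀₁, m2₀₂_of_snd_eq_zero _ _ rfl]
end
end
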